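/- There is no expansive homeomorphism of the circle S¹. -/

import Mathlib

open Filter Topology Function

namespace CircleDeg1Lift

/-- A lift of an orientation preserving circle homeomorphism is expansive if the orbits of any two
distinct points of the line are at least some fixed distance apart at some time. -/
def IsExpansive (G : CircleDeg1Liftˣ) : Prop :=
  ∃ ε > (0 : ℝ), ∀ x y : ℝ, x < y → ∃ n : ℤ, ε ≤ (G ^ n) y - (G ^ n) x

theorem units_strictMono (G : CircleDeg1Liftˣ) : StrictMono G :=
  (toOrderIso G).strictMono

theorem units_continuous (G : CircleDeg1Liftˣ) : Continuous G :=
  (toOrderIso G).continuous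

theorem units_mul_apply (G H : CircleDeg1Liftˣ) (x : ℝ) : (G * H) x = G (H x) := rfl

theorem exists_gap_of_strictMono (g : CircleDeg1Lift) (hg : StrictMono g) {ε : ℝ} (hε : 0 < ε) :
    ∃ η > 0, ∀ x y, x + ε ≤ y → g x + η ≤ g y := by
  obtain ⟨N, hN⟩ := exists_nat_gt (2 / ε)
  have hN0 : (0 : ℝ) < N := lt_trans (by positivity) hN
  have hNε : 2 < ε * N := by rwa [div_lt_iff₀' hε] at hN
  have hne : (Finset.range N).Nonempty := by
    rw [Finset.nonempty_range_iff]; rintro rfl; simp at hN0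
  let w : ℕ → ℝ := fun i => g ((i + 1) / N) - g (i / N)
  have hw : ∀ i, 0 < w i := fun i => sub_pos.2 (hg (by gcongr; linarith))
  obtain ⟨i₀, -, hi₀⟩ := Finset.exists_min_image _ w hne
  refine ⟨w i₀, hw i₀, fun x y hxy => ?_⟩
  set i : ℤ := ⌈x * N⌉
  have h₁ : x ≤ i / N := by rw [le_div_iff₀ hN0]; exact Int.le_ceil _
  have h₂ : (i + 1 : ℝ) / N ≤ y := by
    rw [div_le_iff₀ hN0]
    have := Int.ceil_lt_add_one (x * N)
    nlinarith
  have hNZ : (0 : ℤ) < N := by exact_mod_cast hN0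
  obtain ⟨r, hr⟩ := Int.eq_ofNat_of_zero_le (Int.emod_nonneg i hNZ.ne')
  have hrN : r < N := by have := Int.emod_lt_of_pos i hNZ; omega
  have hi : (i : ℝ) = r + N * (i / N : ℤ) := by
    have := Int.emod_add_mul_ediv i N
    rw [hr] at this
    exact_mod_cast this.symm
  have h₃ : g (i / N) = g (r / N) + (i / N : ℤ) := by
    rw [← map_add_int]; congr 1; rw [hi]; field_simp
  have h₄ : g ((i + 1) / N) = g ((r + 1) / N) + (i / N : ℤ) := by
    rw [← map_add_int]; congr 1; rw [hi]; field_simp; ring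
  have h₅ := hi₀ r (Finset.mem_range.2 hrN)
  have h₆ := g.mono h₁
  have h₇ := g.mono h₂
  simp only [w] at h₅ ⊢
  linarith

theorem exists_units_sub_lt (G : CircleDeg1Liftˣ) {ε : ℝ} (hε : 0 < ε) :
    ∃ δ > 0, ∀ x y, y - x < δ → G y - G x < ε := by
  obtain ⟨η, hη, h⟩ := exists_gap_of_strictMono _ (units_strictMono G⁻¹) hε
  refine ⟨η, hη, fun x y hxy => ?_⟩
  by_contra! hcon
  have := h (G x) (G y) (by linarith)
  simp only [units_inv_apply_apply] at this
  linarith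

namespace IsExpansive

variable {G : CircleDeg1Liftˣ}

theorem inv (hG : IsExpansive G) : IsExpansive G⁻¹ := by
  obtain ⟨ε, hε, h⟩ := hG
  refine ⟨ε, hε, fun x y hxy => ?_⟩
  obtain ⟨n, hn⟩ := h x y hxy
  exact ⟨-n, by simpa using hn⟩

theorem pow (hG : IsExpansive G) {q : ℕ} (hq : 0 < q) : IsExpansive (G ^ q) := by
  obtain ⟨ε, hε, h⟩ := hG
  choose δ hδ hGδ using fun r : ℕ => exists_units_sub_lt (G ^ r) hε
  obtain ⟨r₀, -, hr₀⟩ := Finset.exists_min_image (Finset.range q) δ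
    (Finset.nonempty_range_iff.2 hq.ne')
  refine ⟨δ r₀, hδ r₀, fun x y hxy => ?_⟩
  obtain ⟨n, hn⟩ := h x y hxy
  have hqZ : (0 : ℤ) < q := by exact_mod_cast hq
  obtain ⟨r, hr⟩ := Int.eq_ofNat_of_zero_le (Int.emod_nonneg n hqZ.ne')
  have hrq : r < q := by have := Int.emod_lt_of_pos n hqZ; omega
  refine ⟨n / q, ?_⟩
  by_contra! hcon
  have hlt := hGδ r _ _ (hcon.trans_le (hr₀ r (Finset.mem_range.2 hrq)))
  have hGn : G ^ n = G ^ r * (G ^ q) ^ (n / q) := by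
    conv_lhs => rw [← Int.emod_add_mul_ediv n q, hr]
    rw [zpow_add, zpow_mul, zpow_natCast, zpow_natCast]
  rw [hGn, units_mul_apply, units_mul_apply] at hn
  linarith

theorem translate_mul (hG : IsExpansive G) (p : ℤ) :
    IsExpansive (translate (Multiplicative.ofAdd (p : ℝ)) * G) := by
  obtain ⟨ε, hε, h⟩ := hG
  refine ⟨ε, hε, fun x y hxy => ?_⟩
  obtain ⟨n, hn⟩ := h x y hxy
  have hc : Commute (translate (Multiplicative.ofAdd (p : ℝ))) G := by
    ext x
    simp
  refine ⟨n, ?_⟩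
  rw [hc.mul_zpow, units_mul_apply, units_mul_apply, translate_zpow, translate_apply,
    translate_apply]
  linarith

/-- An expansive lift has no wandering intervals. -/
theorem not_wandering (hG : IsExpansive G) {x y : ℝ} (hxy : x < y) :
    ¬ ∀ n m k : ℤ, n ≠ m → (G ^ n) x ≤ (G ^ m) x + k → (G ^ n) y ≤ (G ^ m) x + k := by
  intro hW
  obtain ⟨ε, hε, h⟩ := hG
  let S : Set ℤ := {n | ε ≤ (G ^ n) y - (G ^ n) x}
  have hS : S.Finite := by
    by_contra hinf
    have hmaps : Set.MapsTo (fun n : ℤ => ⌊2 / ε * Int.fract ((G ^ n) x)⌋) S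
        (Set.Icc 0 ⌊2 / ε⌋) := by
      intro n _
      have h0 := Int.fract_nonneg ((G ^ n) x)
      have h1 := (Int.fract_lt_one ((G ^ n) x)).le
      refine ⟨Int.floor_nonneg.2 (by positivity), Int.floor_le_floor ?_⟩
      exact mul_le_of_le_one_right (by positivity) h1
    obtain ⟨n, hn, m, hm, hnm, heq⟩ :=
      Set.Infinite.exists_ne_map_eq_of_mapsTo hinf hmaps (Set.finite_Icc _ _)
    have habs := Int.abs_sub_lt_one_of_floor_eq_floor heq
    rw [← mul_sub, abs_mul, abs_of_pos (by positivity), div_mul_eq_mul_div, div_lt_one hε,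
      Int.fract, Int.fract] at habs
    have hlt := abs_lt.1 (show |(G ^ n) x - ⌊(G ^ n) x⌋ - ((G ^ m) x - ⌊(G ^ m) x⌋)| < ε by
      linarith [abs_nonneg ((G ^ n) x - ⌊(G ^ n) x⌋ - ((G ^ m) x - ⌊(G ^ m) x⌋))])
    have hn' : ε ≤ (G ^ n) y - (G ^ n) x := hn
    have hm' : ε ≤ (G ^ m) y - (G ^ m) x := hm
    have h₁ := hW n m (⌊(G ^ n) x⌋ - ⌊(G ^ m) x⌋) hnm
    have h₂ := hW m n (⌊(G ^ m) x⌋ - ⌊(G ^ n) x⌋) hnm.symm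
    push_cast at h₁ h₂
    rcases le_total ((G ^ n) x) ((G ^ m) x + (⌊(G ^ n) x⌋ - ⌊(G ^ m) x⌋)) with hle | hle
    · linarith [h₁ hle, hlt.1, hlt.2]
    · linarith [h₂ (by linarith), hlt.1, hlt.2]
  have hev : ∀ᶠ z in 𝓝[>] x, ∀ n ∈ S, (G ^ n) z - (G ^ n) x < ε := by
    refine (eventually_all_finite hS).2 fun n _ => ?_
    have hc : ContinuousAt (fun z => (G ^ n) z - (G ^ n) x) x :=
      ((units_continuous (G ^ n)).sub continuous_const).continuousAt
    exact (hc.eventually_lt_const (by simpa using hε)).filter_mono nhdsWithin_le_nhds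
  obtain ⟨z, hz, hxz, hzy⟩ := (hev.and (Ioo_mem_nhdsGT hxy)).exists
  obtain ⟨n, hn⟩ := h x z hxz
  have hnS : n ∈ S := by
    have := units_strictMono (G ^ n) hzy
    change ε ≤ _
    linarith
  linarith [hz n hnS]

theorem not_wandering_of_fixed (hG : IsExpansive G) {a x : ℝ} (ha : G a = a) (hax : a < x)
    (hxa : x < a + 1) : ¬ x < G x := by
  intro hx
  refine hG.not_wandering hx fun n m k hnm hle => ?_
  have hfix : ∀ n : ℤ, (G ^ n) a = a := fun n => by
    have : (toOrderIso (G ^ n)).toEquiv a = a := by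
      have h := Equiv.Perm.zpow_apply_eq_self_of_apply_eq_self
        (f := (MulAction.toPermHom (ℝ ≃o ℝ) ℝ) (toOrderIso G)) (x := a) ha n
      rw [← map_zpow, ← map_zpow] at h
      exact h
    exact this
  have hlo : ∀ n : ℤ, a < (G ^ n) x := fun n => by
    simpa [hfix n] using units_strictMono (G ^ n) hax
  have hhi : ∀ n : ℤ, (G ^ n) x < a + 1 := fun n => by
    simpa [hfix n] using units_strictMono (G ^ n) hxa
  have hsucc : ∀ n : ℤ, (G ^ n) (G x) = (G ^ (n + 1)) x := fun n => by
    rw [zpow_add_one, units_mul_apply]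
  have hmono : StrictMono fun n : ℤ => (G ^ n) x :=
    strictMono_int_of_lt_succ fun n => by
      rw [← hsucc]; exact units_strictMono (G ^ n) hx
  rw [hsucc]
  rcases lt_trichotomy k 0 with hk | rfl | hk
  · have : (k : ℝ) ≤ -1 := by exact_mod_cast (by omega : k ≤ -1)
    linarith [hlo n, hhi m]
  · simp only [Int.cast_zero, add_zero] at hle ⊢
    have := hmono.le_iff_le.1 hle
    exact hmono.monotone (by omega)
  · have : (1 : ℝ) ≤ k := by exact_mod_cast hk
    linarith [hhi (n + 1), hlo m]

theorem map_ne (hG : IsExpansive G) (a : ℝ) : G a ≠ a := by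
  intro ha
  have hid : ∀ x, G x = x := by
    intro x
    by_contra hx
    set k : ℤ := ⌊x - a⌋
    have hk : G (x - k) - (x - k) = G x - x := by rw [map_sub_int]; ring
    have h₁ : a ≤ x - k := by linarith [Int.floor_le (x - a)]
    have h₂ : x - k < a + 1 := by linarith [Int.lt_floor_add_one (x - a)]
    have h₃ : a < x - k := h₁.lt_of_ne fun h => by
      rw [← h, ha] at hk
      exact hx (by linarith)
    rcases lt_or_gt_of_ne hx with hlt | hlt
    · have ha' : G⁻¹ a = a := by
        conv_lhs => rw [← ha]
        exact units_inv_apply_apply G a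
      refine hG.inv.not_wandering_of_fixed ha' h₃ h₂ ?_
      have := units_strictMono G⁻¹ (show G (x - k) < x - k by linarith)
      rwa [units_inv_apply_apply] at this
    · exact hG.not_wandering_of_fixed ha h₃ h₂ (by linarith)
  obtain rfl : G = 1 := by
    ext x
    exact hid x
  obtain ⟨ε, hε, h⟩ := hG
  obtain ⟨n, hn⟩ := h 0 (ε / 2) (by positivity)
  simp at hn
  linarith

theorem irrational_translationNumber (hG : IsExpansive G) :
    Irrational (translationNumber G) := by
  rintro ⟨q, hq⟩
  rw [Rat.cast_def, eq_comm, translationNumber_eq_rat_iff _ (units_continuous G) q.pos] at hq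
  obtain ⟨x, hx⟩ := hq
  refine ((hG.pow q.pos).translate_mul (-q.num)).map_ne x ?_
  rw [units_mul_apply, translate_apply, Units.val_pow_eq_pow_val, hx]
  push_cast
  ring

end IsExpansive

theorem not_isExpansive (G : CircleDeg1Liftˣ) : ¬ IsExpansive G := by
  intro hG
  have hirr := hG.irrational_translationNumber
  set t := translationNumber G
  obtain ⟨g, hg⟩ := units_semiconj_of_translationNumber_eq
    (f₁ := G) (f₂ := translate (Multiplicative.ofAdd t)) (translationNumber_translate t).symm
  have hgn : ∀ (n : ℤ) (x : ℝ), g ((G ^ n) x) = g x + n * t := by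
    have h1 : ∀ x, g (G x) = g x + t := fun x => by
      rw [hg x, translate_apply, add_comm]
    intro n
    induction n with
    | zero => simp
    | succ n ih =>
      intro x
      rw [zpow_add_one, units_mul_apply, ih, h1]
      push_cast
      ring
    | pred n ih =>
      intro x
      have h2 := h1 (G⁻¹ x)
      rw [units_apply_inv_apply] at h2
      rw [zpow_sub_one, units_mul_apply, ih, h2]
      push_cast
      ring
  by_cases hinj : StrictMono g
  · obtain ⟨ε, hε, h⟩ := hG
    obtain ⟨η, hη, hgap⟩ := exists_gap_of_strictMono g hinj hε
    obtain ⟨x, y, hxy, hlt⟩ : ∃ x y, x < y ∧ g y - g x < η := by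
      obtain ⟨N, hN⟩ := exists_nat_gt (1 / η)
      have hN0 : (0 : ℝ) < N := lt_trans (by positivity) hN
      by_contra! hcon
      have hsum : ∑ i ∈ Finset.range N, (g (((i + 1 : ℕ) : ℝ) / N) - g ((i : ℕ) / N)) = 1 := by
        rw [Finset.sum_range_sub (fun i : ℕ => g (i / N)), div_self hN0.ne']
        simpa [sub_eq_iff_eq_add'] using g.map_add_one 0
      have hle : ∑ i ∈ Finset.range N, η ≤
          ∑ i ∈ Finset.range N, (g (((i + 1 : ℕ) : ℝ) / N) - g ((i : ℕ) / N)) :=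
        Finset.sum_le_sum fun i _ => hcon _ _ (by gcongr; linarith)
      rw [hsum, Finset.sum_const, Finset.card_range, nsmul_eq_mul] at hle
      rw [div_lt_iff₀ hη] at hN
      linarith
    obtain ⟨n, hn⟩ := h x y hxy
    have := hgap _ _ (show (G ^ n) x + ε ≤ (G ^ n) y by linarith)
    rw [hgn, hgn] at this
    linarith
  · rw [StrictMono] at hinj
    push Not at hinj
    obtain ⟨x, y, hxy, hle⟩ := hinj
    refine hG.not_wandering hxy fun n m k hnm h₁ => ?_
    by_contra! h₂
    have e₁ := g.mono h₁
    have e₂ := g.mono h₂.le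
    rw [map_add_int, hgn, hgn] at e₁ e₂
    have hnm' : ((n - m : ℤ) : ℝ) * t = k := by
      push_cast
      linarith
    exact (hirr.intCast_mul (sub_ne_zero.2 hnm)).ne_int k hnm'

end CircleDeg1Lift

namespace Circle

theorem exp_two_pi_mul_eq_iff {x y : ℝ} :
    exp (2 * Real.pi * x) = exp (2 * Real.pi * y) ↔ ∃ k : ℤ, x = y + k := by
  rw [exp_eq_exp]
  refine exists_congr fun k => ?_
  rw [show 2 * Real.pi * y + k * (2 * Real.pi) = 2 * Real.pi * (y + k) by ring]
  exact mul_right_inj' Real.two_pi_pos.ne'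

theorem dist_exp_le (x y : ℝ) : dist (exp x) (exp y) ≤ |x - y| := by
  have h : (exp x : ℂ) - exp y = exp y * (Complex.exp (Complex.I * (x - y : ℝ)) - 1) := by
    rw [coe_exp, coe_exp, mul_sub, mul_one, ← Complex.exp_add]
    congr 2
    push_cast
    ring
  change dist (exp x : ℂ) (exp y) ≤ _
  rw [dist_eq_norm, h, norm_mul, norm_coe, one_mul]
  exact Real.norm_exp_I_mul_ofReal_sub_one_le

theorem exists_lift {f : Circle → Circle} (hf : Continuous f) :
    ∃ F : ℝ → ℝ, Continuous F ∧
      ∀ t, exp (2 * Real.pi * F t) = f (exp (2 * Real.pi * t)) := by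
  let u : C(ℝ, Circle) := ⟨fun t => f (exp (2 * Real.pi * t)), by fun_prop⟩
  obtain ⟨s, hs⟩ := exp_surjective (u 0)
  obtain ⟨F, ⟨-, hF⟩, -⟩ := isCoveringMap_exp.existsUnique_continuousMap_lifts u 0 s hs
  refine ⟨fun t => F t / (2 * Real.pi), by fun_prop, fun t => ?_⟩
  rw [mul_div_cancel₀ _ Real.two_pi_pos.ne']
  exact congrFun hF t

theorem exists_eq_add_int_of_exp_eq {u v : ℝ → ℝ} (hu : Continuous u) (hv : Continuous v)
    (h : ∀ t, exp (2 * Real.pi * u t) = exp (2 * Real.pi * v t)) :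
    ∃ k : ℤ, ∀ t, u t = v t + k := by
  obtain ⟨k, hk⟩ := exp_two_pi_mul_eq_iff.1 (h 0)
  refine ⟨k, fun t => ?_⟩
  have heq := isCoveringMap_exp.eq_of_comp_eq
    (g₁ := fun t => 2 * Real.pi * u t) (g₂ := fun t => 2 * Real.pi * (v t + k))
    (by fun_prop) (by fun_prop)
    (funext fun t => (h t).trans (exp_two_pi_mul_eq_iff.2 ⟨-k, by simp⟩)) 0 (by simp [hk])
  exact mul_left_cancel₀ Real.two_pi_pos.ne' (congrFun heq t)

theorem exists_degree {f : Circle → Circle} {F : ℝ → ℝ} (hF : Continuous F)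
    (h : ∀ t, exp (2 * Real.pi * F t) = f (exp (2 * Real.pi * t))) :
    ∃ d : ℤ, ∀ (t : ℝ) (n : ℤ), F (t + n) = F t + n * d := by
  obtain ⟨d, hd⟩ := exists_eq_add_int_of_exp_eq (u := fun t => F (t + 1)) (v := F)
    (by fun_prop) hF fun t => by
      rw [h, h, (exp_two_pi_mul_eq_iff (x := t + 1) (y := t)).2 ⟨1, by simp⟩]
  refine ⟨d, fun t n => ?_⟩
  have hp : Function.Periodic (fun t => F t - t * d) 1 := fun t => by
    simp only [hd]
    ring
  have := hp.int_mul n t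
  simp only [mul_one] at this
  linarith

/-- The square of a circle homeomorphism preserves orientation, hence lifts to the line. -/
theorem exists_units_lift_sq (f : Equiv.Perm Circle) (hf : Continuous f) (hf' : Continuous f.symm) :
    ∃ G : CircleDeg1Liftˣ, ∀ t : ℝ,
      exp (2 * Real.pi * G t) = (f ^ 2) (exp (2 * Real.pi * t)) := by
  obtain ⟨F, hFc, hF⟩ := exists_lift hf
  obtain ⟨H, hHc, hH⟩ := exists_lift hf'
  obtain ⟨d, hd⟩ := exists_degree hFc hF
  obtain ⟨d', hd'⟩ := exists_degree hHc hH
  obtain ⟨k, hk⟩ := exists_eq_add_int_of_exp_eq (u := fun t => F (H t)) (v := id)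
    (by fun_prop) continuous_id fun t => by simp [hF, hH]
  obtain ⟨l, hl⟩ := exists_eq_add_int_of_exp_eq (u := fun t => H (F t)) (v := id)
    (by fun_prop) continuous_id fun t => by simp [hF, hH]
  simp only [id] at hk hl
  have hdd : d' * d = 1 := by
    have h₁ := hk (0 + (1 : ℤ))
    rw [hd', Int.cast_one, one_mul, hd, hk] at h₁
    have : (d' : ℝ) * d = 1 := by linarith
    exact_mod_cast this
  have hsq : (d : ℝ) * d = 1 := by
    have : d * d = 1 := Int.isUnit_mul_self (IsUnit.of_mul_eq_one_right _ hdd)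
    exact_mod_cast this
  have hinj : Injective F := fun s t hst => by
    have := hl s
    rw [hst, hl] at this
    linarith
  have hsurj : Surjective F := fun s => ⟨H (s - k), by rw [hk]; ring⟩
  have hmono : StrictMono (F ∘ F) := by
    rcases hFc.strictMono_of_inj hinj with h | h
    exacts [h.comp h, h.comp h]
  let G : CircleDeg1Lift := ⟨⟨F ∘ F, hmono.monotone⟩, fun t => by
    have h₁ := hd t 1
    have h₂ := hd (F t) d
    simp only [Int.cast_one, one_mul] at h₁
    simp [h₁, h₂, hsq]⟩
  obtain ⟨G', hG'⟩ := (CircleDeg1Lift.isUnit_iff_bijective (f := G)).2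
    ⟨hinj.comp hinj, hsurj.comp hsurj⟩
  refine ⟨G', fun t => ?_⟩
  rw [hG', sq, Equiv.Perm.mul_apply, ← hF, ← hF]
  rfl

theorem exp_units_zpow_apply {f : Equiv.Perm Circle} {G : CircleDeg1Liftˣ}
    (h : ∀ t : ℝ, exp (2 * Real.pi * G t) = f (exp (2 * Real.pi * t))) (n : ℤ) (t : ℝ) :
    exp (2 * Real.pi * (G ^ n) t) = (f ^ n) (exp (2 * Real.pi * t)) := by
  induction n generalizing t with
  | zero => simp
  | succ n ih =>
    rw [zpow_add_one, CircleDeg1Lift.units_mul_apply, ih, h, zpow_add_one, Equiv.Perm.mul_apply]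
  | pred n ih =>
    rw [zpow_sub_one, CircleDeg1Lift.units_mul_apply, ih, zpow_sub_one, Equiv.Perm.mul_apply]
    congr 1
    rw [Equiv.Perm.eq_inv_iff_eq, ← h, CircleDeg1Lift.units_apply_inv_apply]

end Circle

/-- there is no expansive homeomorphism of the circle S¹. -/
theorem no_expansive_homeo_circle :
    ¬ ∃ (f : Equiv.Perm Circle), Continuous f ∧ Continuous f.symm ∧
      ∃ α > (0 : ℝ), ∀ x y : Circle, x ≠ y →
        ∃ n : ℤ, α ≤ dist ((f ^ n) x) ((f ^ n) y) := by
  rintro ⟨f, hf, hf', α, hα, h⟩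
  obtain ⟨G, hG⟩ := Circle.exists_units_lift_sq f hf hf'
  obtain ⟨δ, hδ, hfδ⟩ := Metric.uniformContinuous_iff.1
    (CompactSpace.uniformContinuous_of_continuous hf) α hα
  have hpi := Real.two_pi_pos
  refine CircleDeg1Lift.not_isExpansive G
    ⟨min 1 (min α δ / (2 * Real.pi)), by positivity, fun x y hxy => ?_⟩
  rcases le_or_gt 1 (y - x) with hle | hlt
  · exact ⟨0, by simpa using Or.inl hle⟩
  have hne : Circle.exp (2 * Real.pi * x) ≠ Circle.exp (2 * Real.pi * y) := by
    rw [Ne, Circle.exp_two_pi_mul_eq_iff]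
    rintro ⟨k, hk⟩
    have h₁ : (k : ℝ) < 0 := by linarith
    have h₂ : (-1 : ℝ) < k := by linarith
    norm_cast at h₁ h₂
    omega
  obtain ⟨n, hn⟩ := h _ _ hne
  obtain ⟨m, hm⟩ : ∃ m : ℤ, min α δ ≤ dist (((f ^ 2) ^ m) (Circle.exp (2 * Real.pi * x)))
      (((f ^ 2) ^ m) (Circle.exp (2 * Real.pi * y))) := by
    have hsq : ∀ m : ℤ, (f ^ 2) ^ m = f ^ (2 * m) := fun m => by
      rw [zpow_mul]; rfl
    obtain ⟨m, rfl | rfl⟩ := Int.even_or_odd' n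
    · exact ⟨m, by rw [hsq]; exact (min_le_left _ _).trans hn⟩
    · refine ⟨m, (min_le_right _ _).trans ?_⟩
      by_contra! hcon
      have := hfδ hcon
      rw [hsq, ← Equiv.Perm.mul_apply, ← Equiv.Perm.mul_apply, ← zpow_one_add, add_comm] at this
      linarith
  refine ⟨m, (min_le_right _ _).trans ?_⟩
  rw [← Circle.exp_units_zpow_apply hG, ← Circle.exp_units_zpow_apply hG] at hm
  have hd := hm.trans (Circle.dist_exp_le _ _)
  rw [← mul_sub, abs_mul, abs_of_pos hpi, abs_sub_comm,
    abs_of_pos (sub_pos.2 (CircleDeg1Lift.units_strictMono _ hxy))] at hd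
  rwa [div_le_iff₀' hpi]
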